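/- Assume α = 1/2 and 0 < β < 1 (region F₁₂*). Then there exist M > 0 and functions λ₁, λ₃ : ℝ → ℂ such that for every μ > M, λ₁(μ), its complex conjugate, λ₃(μ), and its complex conjugate are roots of g(·, μ), and as μ → ∞: Re λ₁(μ) = −(1/18)μ^(β−1)(1+o(1)), Im λ₁(μ) = √3 · μ^(1/2)(1+o(1)), Re λ₃(μ) = −(1/2)(1+o(1)), and Im λ₃(μ) = (√6/3) · μ^(β/2)(1+o(1)). -/

import Mathlib

open Filter Real Topology

/-- Characteristic polynomial of the thermoelastic system with Cattaneo's law,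
without inertial term (`m = 0`), with wave speed `σ = 2`, relaxation `τ = 1`:
`g(λ, μ) = λ⁴ + λ³ + (μ^(2α)+2μ+μ^β)λ² + (μ^(2α)+2μ)λ + 2μ^(1+β)`. -/
noncomputable def charPoly (α β μ : ℝ) (l : ℂ) : ℂ :=
  l ^ 4 + l ^ 3 +
    ((μ ^ (2 * α) + 2 * μ + μ ^ β : ℝ) : ℂ) * l ^ 2 +
    ((μ ^ (2 * α) + 2 * μ : ℝ) : ℂ) * l + ((2 * μ ^ (1 + β) : ℝ) : ℂ)

/-- A real root `k ∈ [0, 1]` of the rescaled resolvent equation whose solutions give the real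
quadratic factorizations of the characteristic polynomial. -/
theorem exists_resolvent_root (t s : ℝ) (ht : 0 ≤ t) (ht' : t ≤ 1 / 2) (hs : 0 ≤ s) :
    ∃ k ∈ Set.Icc (0 : ℝ) 1,
      (3 - k * t * (3 + t - s * (k * t) * (1 - k * t))) *
        (1 - 3 * k - k * t - s * k * (1 - k * t) ^ 2) = 2 * (1 - 2 * (k * t)) ^ 2 := by
  let f : ℝ → ℝ := fun k => (3 - k * t * (3 + t - s * (k * t) * (1 - k * t))) *
    (1 - 3 * k - k * t - s * k * (1 - k * t) ^ 2) - 2 * (1 - 2 * (k * t)) ^ 2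
  have hf : ContinuousOn f (Set.Icc 0 1) := by fun_prop
  have h0 : 0 ≤ f 0 := by norm_num [f]
  have h1 : f 1 ≤ 0 := by
    have hE : 0 ≤ 3 - t * (3 + t - s * t * (1 - t)) := by
      nlinarith [mul_nonneg (mul_nonneg hs ht) (mul_nonneg ht (by linarith : 0 ≤ 1 - t))]
    have hG : 1 - 3 - t - s * (1 - t) ^ 2 ≤ 0 := by
      nlinarith [mul_nonneg hs (sq_nonneg (1 - t))]
    have := mul_nonpos_of_nonneg_of_nonpos hE hG
    simp only [f, one_mul, mul_one]
    nlinarith [sq_nonneg (1 - 2 * t)]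
  obtain ⟨k, hk, hfk⟩ := intermediate_value_Icc' zero_le_one hf ⟨h1, h0⟩
  exact ⟨k, hk, by simp only [f] at hfk; linarith⟩

/-- The root of `z² + u z + v` with nonnegative imaginary part, for `u² ≤ 4 v`. -/
noncomputable def upperRoot (u v : ℝ) : ℂ := ⟨-(u / 2), √(v - u ^ 2 / 4)⟩

theorem upperRoot_isRoot {u v : ℝ} (h : 0 ≤ v - u ^ 2 / 4) :
    upperRoot u v ^ 2 + u * upperRoot u v + v = 0 := by
  have := Real.mul_self_sqrt h
  apply Complex.ext
  · simp only [upperRoot, pow_two] at this ⊢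
    simp
    linarith
  · simp [upperRoot, pow_two]
    ring

theorem conj_upperRoot_isRoot {u v : ℝ} (h : 0 ≤ v - u ^ 2 / 4) :
    (starRingEnd ℂ) (upperRoot u v) ^ 2 + u * (starRingEnd ℂ) (upperRoot u v) + v = 0 := by
  simpa using congrArg (starRingEnd ℂ) (upperRoot_isRoot h)

theorem charPoly_half_eq_mul {β μ a b d : ℝ} (hμ : 0 < μ)
    (h2 : b + d + a * (1 - a) = 3 * μ + μ ^ β) (h1 : a * d + b * (1 - a) = 3 * μ)
    (h0 : b * d = 2 * (μ * μ ^ β)) (z : ℂ) :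
    charPoly (1 / 2) β μ z = (z ^ 2 + a * z + b) * (z ^ 2 + ((1 - a : ℝ) : ℂ) * z + d) := by
  have e1 : μ ^ (2 * (1 / 2 : ℝ)) + 2 * μ + μ ^ β = b + d + a * (1 - a) := by
    norm_num
    linarith
  have e2 : μ ^ (2 * (1 / 2 : ℝ)) + 2 * μ = a * d + b * (1 - a) := by
    norm_num
    linarith
  have e3 : 2 * μ ^ (1 + β) = b * d := by
    rw [Real.rpow_add hμ, Real.rpow_one, h0]
  rw [charPoly, e1, e2, e3]
  push_cast
  ring

theorem tendsto_sqrt_div_sqrt {f g : ℝ → ℝ} (hg : ∀ᶠ x in atTop, 0 ≤ g x)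
    (h : Tendsto (fun x => f x / g x) atTop (𝓝 1)) :
    Tendsto (fun x => √(f x) / √(g x)) atTop (𝓝 1) := by
  have := (Real.continuous_sqrt.tendsto 1).comp h
  rw [Real.sqrt_one] at this
  refine this.congr' ?_
  filter_upwards [hg] with x hx
  exact Real.sqrt_div' _ hx

theorem charPoly_roots_F12_star (α β : ℝ)
    (h1 : α = 1 / 2) (h2 : 0 < β) (h3 : β < 1) :
    ∃ M > (0 : ℝ), ∃ l1 l3 : ℝ → ℂ,
      (∀ μ > M,
        charPoly α β μ (l1 μ) = 0 ∧ charPoly α β μ ((starRingEnd ℂ) (l1 μ)) = 0 ∧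
        charPoly α β μ (l3 μ) = 0 ∧ charPoly α β μ ((starRingEnd ℂ) (l3 μ)) = 0) ∧
      Tendsto (fun μ : ℝ => (l1 μ).re / (-(1 / 18) * μ ^ (β - 1))) atTop (𝓝 1) ∧
      Tendsto (fun μ : ℝ => (l1 μ).im / (Real.sqrt 3 * μ ^ ((1 : ℝ) / 2))) atTop (𝓝 1) ∧
      Tendsto (fun μ : ℝ => (l3 μ).re / (-(1 / 2) : ℝ)) atTop (𝓝 1) ∧
      Tendsto (fun μ : ℝ => (l3 μ).im / (Real.sqrt 6 / 3 * μ ^ (β / 2))) atTop (𝓝 1) := by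
  subst h1
  have ht : Tendsto (fun μ : ℝ => μ ^ (β - 1)) atTop (𝓝 0) := by
    simpa using tendsto_rpow_neg_atTop (show 0 < 1 - β by linarith)
  have hs : Tendsto (fun μ : ℝ => μ⁻¹) atTop (𝓝 0) := tendsto_inv_atTop_zero
  have hq : Tendsto (fun μ : ℝ => (μ ^ β)⁻¹) atTop (𝓝 0) :=
    tendsto_inv_atTop_zero.comp (tendsto_rpow_atTop h2)
  have hgood : ∀ᶠ μ : ℝ in atTop, 0 < μ ∧ μ ^ (β - 1) ≤ 1 / 2 := by
    filter_upwards [eventually_gt_atTop 0, ht.eventually (ge_mem_nhds (by norm_num : (0:ℝ) < 1/2))]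
      with μ a b using ⟨a, b⟩
  have hex : ∀ μ : ℝ, ∃ k : ℝ, 0 < μ ∧ μ ^ (β - 1) ≤ 1 / 2 →
      k ∈ Set.Icc (0 : ℝ) 1 ∧
      (3 - k * μ ^ (β - 1) * (3 + μ ^ (β - 1) - μ⁻¹ * (k * μ ^ (β - 1)) *
        (1 - k * μ ^ (β - 1)))) *
        (1 - 3 * k - k * μ ^ (β - 1) - μ⁻¹ * k * (1 - k * μ ^ (β - 1)) ^ 2) =
          2 * (1 - 2 * (k * μ ^ (β - 1))) ^ 2 := by
    intro μ
    by_cases h : 0 < μ ∧ μ ^ (β - 1) ≤ 1 / 2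
    · obtain ⟨k, hk⟩ := exists_resolvent_root (μ ^ (β - 1)) μ⁻¹
        (Real.rpow_nonneg h.1.le _) h.2 (inv_nonneg.2 h.1.le)
      exact ⟨k, fun _ => hk⟩
    · exact ⟨0, fun h' => absurd h' h⟩
  choose k hk using hex
  have hbdd : ∀ᶠ μ in atTop, |k μ| ≤ 1 := by
    filter_upwards [hgood] with μ h
    have := (hk μ h).1
    exact abs_le.2 ⟨by linarith [this.1], this.2⟩
  have hb : IsBoundedUnder (· ≤ ·) atTop (fun μ => ‖k μ‖) := ⟨1, by simpa using hbdd⟩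
  set a : ℝ → ℝ := fun μ => k μ * μ ^ (β - 1) with ha_def
  set E : ℝ → ℝ := fun μ => 3 - a μ * (3 + μ ^ (β - 1) - μ⁻¹ * a μ * (1 - a μ)) with hE_def
  set G : ℝ → ℝ := fun μ => 1 - 3 * k μ - a μ - μ⁻¹ * k μ * (1 - a μ) ^ 2 with hG_def
  have hEG : ∀ᶠ μ in atTop, E μ * G μ = 2 * (1 - 2 * a μ) ^ 2 := by
    filter_upwards [hgood] with μ h using (hk μ h).2
  have ha : Tendsto a atTop (𝓝 0) := isBoundedUnder_le_mul_tendsto_zero hb ht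
  have hsk : Tendsto (fun μ => μ⁻¹ * k μ) atTop (𝓝 0) := by
    simpa [mul_comm] using isBoundedUnder_le_mul_tendsto_zero hb hs
  have hE : Tendsto E atTop (𝓝 3) := by
    have := (tendsto_const_nhds (x := (3 : ℝ))).sub
      (ha.mul (((tendsto_const_nhds (x := (3 : ℝ))).add ht).sub
        ((hs.mul ha).mul ((tendsto_const_nhds (x := (1 : ℝ))).sub ha))))
    simpa using this
  have hw : Tendsto (fun μ => 1 - 2 * a μ) atTop (𝓝 1) := by
    simpa using (ha.const_mul 2).const_sub 1
  have hG : Tendsto G atTop (𝓝 (2 / 3)) := by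
    have := ((hw.pow 2).const_mul 2).div hE (by norm_num)
    norm_num at this
    refine this.congr' ?_
    filter_upwards [hEG, hE.eventually_ne (by norm_num : (3:ℝ) ≠ 0)] with μ h h0
    simp only [Pi.div_apply]
    rw [← h, mul_div_cancel_left₀ _ h0]
  have hklim : Tendsto k atTop (𝓝 (1 / 9)) := by
    have := (((ha.const_sub 1).sub (hsk.mul ((ha.const_sub 1).pow 2))).sub hG).div_const 3
    norm_num at this
    refine this.congr fun μ => ?_
    simp only [hG_def]
    ring
  have hB : Tendsto (fun μ => E μ / (1 - 2 * a μ)) atTop (𝓝 3) := by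
    simpa [Pi.div_def] using hE.div hw one_ne_zero
  have hD : Tendsto (fun μ => G μ / (1 - 2 * a μ)) atTop (𝓝 (2 / 3)) := by
    simpa [Pi.div_def] using hG.div hw one_ne_zero
  set b : ℝ → ℝ := fun μ => μ * (E μ / (1 - 2 * a μ)) with hb_def
  set d : ℝ → ℝ := fun μ => μ ^ β * (G μ / (1 - 2 * a μ)) with hd_def
  have hΔ₁ : Tendsto (fun μ => (b μ - a μ ^ 2 / 4) / (3 * μ)) atTop (𝓝 1) := by
    have := (hB.sub (((ha.pow 2).div_const 4).mul hs)).div_const 3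
    norm_num at this
    refine this.congr' ?_
    filter_upwards [eventually_gt_atTop 0] with μ hμ
    simp only [hb_def]
    generalize E μ / (1 - 2 * a μ) = B
    field_simp
  have hΔ₃ : Tendsto (fun μ => (d μ - (1 - a μ) ^ 2 / 4) / (2 / 3 * μ ^ β)) atTop (𝓝 1) := by
    have := (hD.sub ((((ha.const_sub 1).pow 2).div_const 4).mul hq)).div_const (2 / 3)
    norm_num at this
    refine this.congr' ?_
    filter_upwards [eventually_gt_atTop 0] with μ hμ
    have : 0 < μ ^ β := Real.rpow_pos_of_pos hμ _
    simp only [hd_def]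
    generalize G μ / (1 - 2 * a μ) = D
    field_simp
  have hroots : ∀ᶠ μ : ℝ in atTop, 0 < μ ∧ 0 ≤ b μ - a μ ^ 2 / 4 ∧
      0 ≤ d μ - (1 - a μ) ^ 2 / 4 ∧ ∀ z, charPoly (1 / 2) β μ z =
        (z ^ 2 + a μ * z + b μ) * (z ^ 2 + ((1 - a μ : ℝ) : ℂ) * z + d μ) := by
    filter_upwards [eventually_gt_atTop 0, hΔ₁.eventually (lt_mem_nhds one_pos),
      hΔ₃.eventually (lt_mem_nhds one_pos), hEG, hw.eventually_ne one_ne_zero]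
      with μ hμ h₁ h₃ hEGμ hwμ
    have hqμ : 0 < μ ^ β := Real.rpow_pos_of_pos hμ _
    have htq : μ ^ (β - 1) * μ = μ ^ β := by
      rw [Real.rpow_sub_one hμ.ne', div_mul_cancel₀ _ hμ.ne']
    have hqG : μ ^ β * G μ = μ ^ β - 3 * (μ * a μ) - μ ^ β * a μ - a μ * (1 - a μ) ^ 2 := by
      simp only [hG_def, ha_def, ← htq]
      field_simp
    have hpE : μ * E μ =
        3 * μ - a μ * (3 * μ + μ ^ β - a μ * (1 - a μ)) := by
      simp only [hE_def, ← htq]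
      field_simp
    have hbw : b μ * (1 - 2 * a μ) = μ * E μ := by
      simp only [hb_def]
      field_simp
    have hdw : d μ * (1 - 2 * a μ) = μ ^ β * G μ := by
      simp only [hd_def]
      field_simp
    refine ⟨hμ, ?_, ?_, charPoly_half_eq_mul hμ ?_ ?_ ?_⟩
    · exact ((div_pos_iff_of_pos_right (by positivity)).1 h₁).le
    · exact ((div_pos_iff_of_pos_right (by positivity)).1 h₃).le
    · apply mul_right_cancel₀ hwμ
      linear_combination hbw + hdw + hpE + hqG
    · apply mul_right_cancel₀ hwμ
      linear_combination (1 - a μ) * (hbw + hpE) + a μ * (hdw + hqG)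
    · apply mul_right_cancel₀ (pow_ne_zero 2 hwμ)
      linear_combination d μ * (1 - 2 * a μ) * hbw + μ * E μ * hdw + μ * μ ^ β * hEGμ
  obtain ⟨M, hM⟩ := eventually_atTop.1 hroots
  refine ⟨max M 1, by positivity, fun μ => upperRoot (a μ) (b μ),
    fun μ => upperRoot (1 - a μ) (d μ), fun μ hμ => ?_, ?_, ?_, ?_, ?_⟩
  · obtain ⟨-, h₁, h₃, hfac⟩ := hM μ ((le_max_left M 1).trans hμ.le)
    simp only [hfac, upperRoot_isRoot h₁, conj_upperRoot_isRoot h₁, upperRoot_isRoot h₃,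
      conj_upperRoot_isRoot h₃, zero_mul, mul_zero, and_self]
  · have := hklim.const_mul 9
    norm_num at this
    refine this.congr' ?_
    filter_upwards [eventually_gt_atTop 0] with μ hμ
    have : 0 < μ ^ (β - 1) := Real.rpow_pos_of_pos hμ _
    simp only [upperRoot, ha_def]
    field_simp
    ring
  · refine (tendsto_sqrt_div_sqrt ?_ hΔ₁).congr fun μ => ?_
    · filter_upwards [eventually_ge_atTop 0] with μ hμ
      positivity
    · rw [Real.sqrt_mul (by norm_num), Real.sqrt_eq_rpow μ]
      rfl
  · have := ha.const_sub 1
    rw [sub_zero] at this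
    refine this.congr fun μ => ?_
    simp only [upperRoot]
    ring
  · refine (tendsto_sqrt_div_sqrt ?_ hΔ₃).congr' ?_
    · filter_upwards [eventually_ge_atTop 0] with μ hμ
      positivity
    · filter_upwards [eventually_ge_atTop 0] with μ hμ
      have h6 : √(2 / 3) = √6 / 3 := by
        rw [show (2 / 3 : ℝ) = 6 / 3 ^ 2 by norm_num, Real.sqrt_div (by norm_num),
          Real.sqrt_sq (by norm_num)]
      rw [Real.sqrt_mul (by norm_num), h6, Real.sqrt_eq_rpow (μ ^ β), ← Real.rpow_mul hμ,
        mul_one_div]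
      rfl
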